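/- If isBST t holds and p is a node position of t with key(t,p) = k, then for every y : ℤ, MapP t p † {k ↦ y} = Map t † {k ↦ y} (as functions ℤ → Option ℤ). -/

import Mathlib

namespace ScopeLogicBST

/-- Binary trees whose nodes carry an integer key and integer data. -/
inductive T : Type where
  | leaf : T
  | node : T → T → ℤ → ℤ → T

/-- The key set of a tree. -/
def Dom : T → Finset ℤ
  | .leaf => ∅
  | .node l r K _ => {K} ∪ Dom l ∪ Dom r

/-- The finite map defined only at `K`, with value `D`. -/
def single (K D : ℤ) : ℤ → Option ℤ := fun k => if k = K then some D else none

/-- Right-biased override of finite maps. -/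
def ovr (M M' : ℤ → Option ℤ) : ℤ → Option ℤ := fun k =>
  match M' k with
  | some v => some v
  | none => M k

infixl:65 " † " => ovr

/-- The finite map retrieved from a tree. -/
def Map : T → ℤ → Option ℤ
  | .leaf => fun _ => none
  | .node l r K D => (single K D † Map l) † Map r

/-- Binary-search-tree property. -/
def isBST : T → Prop
  | .leaf => True
  | .node l r K _ =>
      isBST l ∧ isBST r ∧ (∀ k ∈ Dom l, k < K) ∧ (∀ k ∈ Dom r, K < k)

end ScopeLogicBST

namespace ScopeLogicBST

/-- Directions into a binary tree. -/
inductive Dir : Type where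
  | L : Dir
  | R : Dir

/-- The subtree of a tree at a given position, if any. -/
def subtree : T → List Dir → Option T
  | t, [] => some t
  | .leaf, _ :: _ => none
  | .node l _ _ _, .L :: p => subtree l p
  | .node _ r _ _, .R :: p => subtree r p

end ScopeLogicBST

namespace ScopeLogicBST

/-- The map of `t` with the single entry contributed by the node at position `p` omitted. -/
def MapP : T → List Dir → ℤ → Option ℤ
  | .leaf, _ => fun _ => none
  | .node l r _ _, [] => Map l † Map r
  | .node l r K D, .L :: p => (single K D † MapP l p) † Map r
  | .node l r K D, .R :: p => (single K D † Map l) † MapP r p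

end ScopeLogicBST

open ScopeLogicBST

theorem mapP_apply_of_ne {t : T} {p : List Dir} {l r : T} {k D x : ℤ}
    (hp : subtree t p = some (T.node l r k D)) (hx : x ≠ k) : MapP t p x = Map t x := by
  induction t generalizing p with
  | leaf => cases p <;> simp [subtree] at hp
  | node a b K E iha ihb =>
    match p with
    | [] =>
      simp only [subtree, Option.some.injEq, T.node.injEq] at hp
      obtain ⟨-, -, rfl, -⟩ := hp
      simp only [MapP, Map, ovr, single, if_neg hx]
      cases Map b x <;> cases Map a x <;> rfl
    | .L :: p =>
      simp only [subtree] at hp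
      simp only [MapP, Map, ovr, iha hp]
    | .R :: p =>
      simp only [subtree] at hp
      simp only [MapP, Map, ovr, ihb hp]

theorem mapP_override_eq_map_override (t : T) (p : List Dir) (l' r' : T) (k Dp : ℤ)
    (hbst : isBST t) (hp : subtree t p = some (T.node l' r' k Dp)) :
    ∀ y : ℤ, MapP t p † single k y = Map t † single k y := by
  intro y
  funext x
  by_cases hx : x = k
  · simp [ovr, single, hx]
  · simp [ovr, single, hx, mapP_apply_of_ne hp hx]
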